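/- arXiv:2106.12959 — 3 statements merged into one kernel-verified Lean document; each statement's English description precedes it below -/
import Mathlib

section
/- Let α ≥ 0 and 0 < φ < 1 satisfy (α+φ)/(1−φ) < 1/4. Let X be a finite multiset of points in ℝ^d that is φ-separated for k-median (k ≥ 2), let C* = {c*₁,…,c*_k} be an optimal k-median center set for X whose induced clusters X*₁,…,X*_k are all nonempty, and let Ĉ = (ĉ₁,…,ĉ_k) be any k centers with cost¹_X(Ĉ) ≤ α·OPT¹_{k−1}(X). Then there is a permutation π of {1,…,k} such that for every i, ‖ĉ_i − c*_{π(i)}‖ ≤ 2·((α+φ)/(1−φ))·D_{π(i)}, where D_j = min_{l≠j} ‖c*_j − c*_l‖. -/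
open scoped BigOperators Classical

/-- The `p`-objective clustering cost of the multiset `X` w.r.t. the centers `C`. -/
noncomputable def kmcost (p : ℕ) {d k : ℕ} (X : Multiset (EuclideanSpace ℝ (Fin d)))
    (C : Fin k → EuclideanSpace ℝ (Fin d)) : ℝ :=
  (X.map fun x => ⨅ i, ‖x - C i‖ ^ p).sum

/-- The optimal `p`-objective `k`-clustering cost of the multiset `X`. -/
noncomputable def kmOPT (p : ℕ) {d : ℕ} (k : ℕ) (X : Multiset (EuclideanSpace ℝ (Fin d))) : ℝ :=
  ⨅ C : Fin k → EuclideanSpace ℝ (Fin d), kmcost p X C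

/-- `Dmin C i = min_{j ≠ i} ‖C i - C j‖`. -/
noncomputable def Dmin {d k : ℕ} (C : Fin k → EuclideanSpace ℝ (Fin d)) (i : Fin k) : ℝ :=
  ⨅ j : {j : Fin k // j ≠ i}, ‖C i - C j.1‖

/-- The mean of a finite multiset of points. -/
noncomputable def mmean {d : ℕ} (S : Multiset (EuclideanSpace ℝ (Fin d))) :
    EuclideanSpace ℝ (Fin d) :=
  (S.card : ℝ)⁻¹ • S.sum

theorem aux_inf_le {d k : ℕ} (C : Fin k → EuclideanSpace ℝ (Fin d))
    (x : EuclideanSpace ℝ (Fin d)) (j : Fin k) : (⨅ i, ‖x - C i‖ ^ 1) ≤ ‖x - C j‖ := by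
  have := ciInf_le (f := fun i => ‖x - C i‖ ^ 1) (Set.finite_range _).bddBelow j
  simpa using this

theorem aux_split {d k m : ℕ} (X : Multiset (EuclideanSpace ℝ (Fin d)))
    (Xc : Fin k → Multiset (EuclideanSpace ℝ (Fin d)))
    (hpart : ∑ i, Xc i = X) (C : Fin m → EuclideanSpace ℝ (Fin d)) :
    kmcost 1 X C = ∑ i, ((Xc i).map fun x => ⨅ j, ‖x - C j‖ ^ 1).sum := by
  unfold kmcost
  rw [← hpart]
  have h := map_sum (Multiset.mapAddMonoidHom
    (fun x : EuclideanSpace ℝ (Fin d) => ⨅ j, ‖x - C j‖ ^ 1)) Xc Finset.univ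
  simp only [Multiset.coe_mapAddMonoidHom] at h
  rw [h]
  exact map_sum (Multiset.sumAddMonoidHom : Multiset ℝ →+ ℝ) _ _

theorem aux_inf_nonneg {d k : ℕ} (C : Fin k → EuclideanSpace ℝ (Fin d))
    (x : EuclideanSpace ℝ (Fin d)) : 0 ≤ (⨅ i, ‖x - C i‖ ^ 1) :=
  Real.iInf_nonneg fun i => by positivity

theorem aux_cost_nonneg {d k : ℕ} (X : Multiset (EuclideanSpace ℝ (Fin d)))
    (C : Fin k → EuclideanSpace ℝ (Fin d)) : 0 ≤ kmcost 1 X C := by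
  unfold kmcost
  apply Multiset.sum_nonneg
  intro y hy
  obtain ⟨x, -, rfl⟩ := Multiset.mem_map.1 hy
  exact aux_inf_nonneg C x

/-- Theorem 5.1 of Ostrovsky et al. for `k`-median: if `X` is `φ`-separated and `Ĉ` has
`k`-median cost at most `α · OPT¹_{k-1}(X)`, then the centers of `Ĉ` match the optimal centers
up to distance `2·((α+φ)/(1-φ))·D_i`. -/
theorem stmt1 {d k : ℕ} (hk : 2 ≤ k) (α φ : ℝ) (hα : 0 ≤ α) (hφ0 : 0 < φ) (hφ1 : φ < 1)
    (hcond : (α + φ) / (1 - φ) < 1 / 4)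
    (X : Multiset (EuclideanSpace ℝ (Fin d)))
    (Cstar : Fin k → EuclideanSpace ℝ (Fin d)) (hinj : Function.Injective Cstar)
    (hopt : kmcost 1 X Cstar = kmOPT 1 k X)
    (hsep : kmOPT 1 k X ≤ φ * kmOPT 1 (k - 1) X)
    (Xc : Fin k → Multiset (EuclideanSpace ℝ (Fin d)))
    (hpart : ∑ i, Xc i = X)
    (hassign : ∀ i, ∀ x ∈ Xc i, ∀ j, ‖x - Cstar i‖ ≤ ‖x - Cstar j‖)
    (hne : ∀ i, Xc i ≠ 0)
    (Chat : Fin k → EuclideanSpace ℝ (Fin d))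
    (hChat : kmcost 1 X Chat ≤ α * kmOPT 1 (k - 1) X) :
    ∃ π : Equiv.Perm (Fin k), ∀ i,
      ‖Chat i - Cstar (π i)‖ ≤ 2 * ((α + φ) / (1 - φ)) * Dmin Cstar (π i) := by
  obtain ⟨m, rfl⟩ : ∃ m, k = m + 1 := ⟨k - 1, by omega⟩
  simp only [Nat.add_sub_cancel] at hsep hChat
  haveI : Nonempty (Fin m) := ⟨⟨0, by omega⟩⟩
  haveI hnt : Nontrivial (Fin (m + 1)) := Fin.nontrivial_iff_two_le.2 hk
  haveI hne' : ∀ i : Fin (m + 1), Nonempty {j : Fin (m + 1) // j ≠ i} := fun i => by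
    obtain ⟨j, hj⟩ := exists_ne i
    exact ⟨⟨j, hj⟩⟩
  set O := kmOPT 1 m X with hO
  set β := (α + φ) / (1 - φ) with hβ
  have h1φ : 0 < 1 - φ := by linarith
  have hDle : ∀ i j, j ≠ i → Dmin Cstar i ≤ ‖Cstar i - Cstar j‖ := fun i j hij =>
    ciInf_le (f := fun j : {j : Fin (m + 1) // j ≠ i} => ‖Cstar i - Cstar j.1‖)
      (Set.finite_range _).bddBelow ⟨j, hij⟩
  have hDnn : ∀ i, 0 ≤ Dmin Cstar i := fun i => Real.iInf_nonneg fun j => norm_nonneg _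
  have hDat : ∀ i, ∃ j, j ≠ i ∧ ‖Cstar i - Cstar j‖ = Dmin Cstar i := fun i => by
    obtain ⟨j, hj⟩ := exists_eq_ciInf_of_finite
      (f := fun j : {j : Fin (m + 1) // j ≠ i} => ‖Cstar i - Cstar j.1‖)
    exact ⟨j.1, j.2, hj⟩
  -- cost of the optimal clusters
  have hcstar : kmcost 1 X Cstar = ∑ i, ((Xc i).map fun x => ‖x - Cstar i‖).sum := by
    rw [aux_split X Xc hpart]
    refine Finset.sum_congr rfl fun i _ => ?_
    congr 1
    refine Multiset.map_congr rfl fun x hx => ?_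
    refine le_antisymm (aux_inf_le _ _ _) (le_ciInf fun j => ?_)
    simpa using hassign i x hx j
  have hSnn : ∀ i, 0 ≤ ((Xc i).map fun x => ‖x - Cstar i‖).sum := fun i => by
    apply Multiset.sum_nonneg
    intro y hy
    obtain ⟨x, -, rfl⟩ := Multiset.mem_map.1 hy
    exact norm_nonneg _
  have hS : ∀ i, ((Xc i).map fun x => ‖x - Cstar i‖).sum ≤ φ * O := fun i => by
    calc _ ≤ ∑ i, ((Xc i).map fun x => ‖x - Cstar i‖).sum :=
          Finset.single_le_sum (f := fun i => ((Xc i).map fun x => ‖x - Cstar i‖).sum)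
            (fun i _ => hSnn i) (Finset.mem_univ i)
      _ ≤ _ := by rw [← hcstar, hopt]; exact hsep
  have hOle : ∀ i, O ≤ φ * O + (Xc i).card * Dmin Cstar i := fun i => by
    obtain ⟨j, hji, hj⟩ := hDat i
    have h1 : O ≤ kmcost 1 X (fun l => Cstar (i.succAbove l)) :=
      ciInf_le (f := fun C : Fin m → EuclideanSpace ℝ (Fin d) => kmcost 1 X C)
        ⟨0, by rintro _ ⟨C, rfl⟩; exact aux_cost_nonneg X C⟩ _
    have h2 : kmcost 1 X (fun l => Cstar (i.succAbove l)) ≤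
        ∑ l, (((Xc l).map fun x => ‖x - Cstar l‖).sum +
          if l = i then (Xc i).card * Dmin Cstar i else 0) := by
      rw [aux_split X Xc hpart]
      refine Finset.sum_le_sum fun l _ => ?_
      split_ifs with hl
      · subst hl
        have : ((Xc l).map fun x => ‖x - Cstar l‖).sum + (Xc l).card * Dmin Cstar l
            = ((Xc l).map fun x => ‖x - Cstar l‖ + Dmin Cstar l).sum := by
          simp [Multiset.sum_map_add]
        rw [this]
        refine Multiset.sum_map_le_sum_map _ _ fun x hx => ?_
        obtain ⟨t, rfl⟩ := Fin.exists_succAbove_eq hji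
        refine (aux_inf_le _ x t).trans ?_
        rw [← hj]
        exact norm_sub_le_norm_sub_add_norm_sub _ _ _
      · rw [add_zero]
        refine Multiset.sum_map_le_sum_map _ _ fun x hx => ?_
        obtain ⟨t, rfl⟩ := Fin.exists_succAbove_eq hl
        exact aux_inf_le (fun l => Cstar (i.succAbove l)) x t
    rw [Finset.sum_add_distrib, ← hcstar, hopt] at h2
    simp only [Finset.sum_ite_eq', Finset.mem_univ, if_true] at h2
    linarith
  have key : ∀ i, ∃ j, ‖Chat j - Cstar i‖ ≤ β * Dmin Cstar i := fun i => by
    obtain ⟨j, hj⟩ := Finite.exists_min (fun j => ‖Chat j - Cstar i‖)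
    refine ⟨j, ?_⟩
    have hn : (0 : ℝ) < (Xc i).card := by
      exact_mod_cast Multiset.card_pos.2 (hne i)
    have h1 : (Xc i).card * ‖Chat j - Cstar i‖ ≤
        ((Xc i).map fun x => ⨅ j, ‖x - Chat j‖ ^ 1).sum +
          ((Xc i).map fun x => ‖x - Cstar i‖).sum := by
      rw [← Multiset.sum_map_add]
      have : (Xc i).card * ‖Chat j - Cstar i‖ =
          ((Xc i).map fun _ => ‖Chat j - Cstar i‖).sum := by simp
      rw [this]
      refine Multiset.sum_map_le_sum_map _ _ fun x hx => ?_
      rw [← sub_le_iff_le_add]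
      refine le_ciInf fun t => ?_
      have h3 := hj t
      have h4 := norm_sub_le_norm_sub_add_norm_sub (Chat t) x (Cstar i)
      rw [norm_sub_rev (Chat t) x] at h4
      simp only [pow_one]
      linarith
    have h2 : ((Xc i).map fun x => ⨅ j, ‖x - Chat j‖ ^ 1).sum ≤ α * O := by
      refine le_trans ?_ hChat
      rw [aux_split X Xc hpart]
      refine Finset.single_le_sum
        (f := fun i => ((Xc i).map fun x => ⨅ j, ‖x - Chat j‖ ^ 1).sum)
        (fun i _ => ?_) (Finset.mem_univ i)
      exact aux_cost_nonneg (Xc i) Chat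
    have h3 : (α + φ) * ((1 - φ) * O) ≤ (α + φ) * ((Xc i).card * Dmin Cstar i) :=
      mul_le_mul_of_nonneg_left (by linarith [hOle i]) (by linarith)
    have h4 : (1 - φ) * ((Xc i).card * ‖Chat j - Cstar i‖) ≤ (1 - φ) * ((α + φ) * O) :=
      mul_le_mul_of_nonneg_left (by linarith [hS i]) h1φ.le
    rw [hβ, div_mul_eq_mul_div, le_div_iff₀ h1φ]
    refine le_of_mul_le_mul_left ?_ hn
    linarith
  have hβ0 : 0 ≤ β := div_nonneg (by linarith) h1φ.le
  choose σ hσ using key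
  have hinjσ : Function.Injective σ := by
    intro a b hab
    by_contra hne2
    have h1 := hσ a
    have h2 := hσ b
    rw [← hab] at h2
    have h3 := norm_sub_le_norm_sub_add_norm_sub (Cstar a) (Chat (σ a)) (Cstar b)
    rw [norm_sub_rev (Cstar a) (Chat (σ a))] at h3
    have h4 := hDle a b (Ne.symm hne2)
    have h5 := hDle b a hne2
    rw [norm_sub_rev] at h5
    have h6 : 0 < ‖Cstar a - Cstar b‖ :=
      norm_pos_iff.2 (sub_ne_zero.2 fun h => hne2 (hinj h))
    have h7 := mul_le_mul_of_nonneg_left h4 hβ0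
    have h8 := mul_le_mul_of_nonneg_left h5 hβ0
    have h9 := mul_lt_mul_of_pos_right hcond h6
    linarith
  let e : Equiv.Perm (Fin (m + 1)) :=
    Equiv.ofBijective σ (Finite.injective_iff_bijective.1 hinjσ)
  refine ⟨e.symm, fun i => ?_⟩
  have h := hσ (e.symm i)
  have he : σ (e.symm i) = i := e.apply_symm_apply i
  rw [he] at h
  have := mul_nonneg hβ0 (hDnn (e.symm i))
  linarith
end

section
/- Let 0 < φ < 1, w ≥ 0 satisfy φ²(w+1)/(1−φ²) ≤ 1/784, and set γ = 2·√(φ²(w+1)/(1−φ²)) and ρ = 100φ²/(1−φ²). Let X be a finite multiset of points in ℝ^d that is φ-separated for k-means (k ≥ 2), with optimal centers C* = {c*₁,…,c*_k} whose induced clusters X*₁,…,X*_k are all nonempty. Let B = {b₁,…,b_k} be centers with cost²_X(B) ≤ w·φ²·OPT²_{k−1}(X), indexed so that ‖b_i − c*_i‖ ≤ γ·D_i for every i. Define D̂_i = min_{j≠i} ‖b_i − b_j‖, X̂_i = {x ∈ X : ‖x − b_i‖ ≤ D̂_i/3}, and X_i^cor = {x ∈ X*_i : ‖x − c*_i‖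 ≤ r*_i/√ρ}. Then for every i, X_i^cor ⊆ X̂_i ⊆ X*_i. -/
open scoped BigOperators Classical

theorem aux_cost_le {d k m : ℕ} (Xc : Fin k → Multiset (EuclideanSpace ℝ (Fin d)))
    (C : Fin m → EuclideanSpace ℝ (Fin d)) (f : Fin k → Fin m) :
    kmcost 2 (∑ i, Xc i) C ≤ ∑ j, ((Xc j).map fun x => ‖x - C (f j)‖ ^ 2).sum := by
  have h : ∀ s : Finset (Fin k), kmcost 2 (∑ i ∈ s, Xc i) C = ∑ i ∈ s, kmcost 2 (Xc i) C := by
    intro s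
    induction s using Finset.induction_on with
    | empty => simp [kmcost]
    | insert a s ha ih =>
      rw [Finset.sum_insert ha, Finset.sum_insert ha, ← ih]
      simp [kmcost]
  rw [h]
  refine Finset.sum_le_sum fun j _ => ?_
  refine Multiset.sum_map_le_sum_map _ _ fun x _ => ?_
  exact ciInf_le (Set.finite_range _).bddBelow (f j)

theorem aux_cost_eq {d k : ℕ} (hk : 0 < k) (Xc : Fin k → Multiset (EuclideanSpace ℝ (Fin d)))
    (C : Fin k → EuclideanSpace ℝ (Fin d))
    (hassign : ∀ i, ∀ x ∈ Xc i, ∀ j, ‖x - C i‖ ≤ ‖x - C j‖) :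
    ∑ j, ((Xc j).map fun x => ‖x - C j‖ ^ 2).sum ≤ kmcost 2 (∑ i, Xc i) C := by
  have h : ∀ s : Finset (Fin k), kmcost 2 (∑ i ∈ s, Xc i) C = ∑ i ∈ s, kmcost 2 (Xc i) C := by
    intro s
    induction s using Finset.induction_on with
    | empty => simp [kmcost]
    | insert a s ha ih =>
      rw [Finset.sum_insert ha, Finset.sum_insert ha, ← ih]
      simp [kmcost]
  rw [h]
  haveI : Nonempty (Fin k) := ⟨⟨0, hk⟩⟩
  refine Finset.sum_le_sum fun j _ => ?_
  refine Multiset.sum_map_le_sum_map _ _ fun x hx => ?_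
  exact le_ciInf fun i => by gcongr; exact hassign j x hx i

theorem aux_opt_le {d k : ℕ} (X : Multiset (EuclideanSpace ℝ (Fin d)))
    (C : Fin k → EuclideanSpace ℝ (Fin d)) : kmOPT 2 k X ≤ kmcost 2 X C := by
  refine ciInf_le ⟨0, ?_⟩ C
  rintro _ ⟨C, rfl⟩
  refine Multiset.sum_nonneg ?_
  intro a ha
  obtain ⟨x, -, rfl⟩ := Multiset.mem_map.1 ha
  exact Real.iInf_nonneg fun i => by positivity

theorem aux_shift {d : ℕ} (S : Multiset (EuclideanSpace ℝ (Fin d)))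
    (c v : EuclideanSpace ℝ (Fin d)) :
    (S.map fun x => ‖x - v‖ ^ 2).sum = (S.map fun x => ‖x - c‖ ^ 2).sum
      - 2 * inner ℝ (S.map fun x => x - c).sum (v - c) + S.card * ‖v - c‖ ^ 2 := by
  induction S using Multiset.induction_on with
  | empty => simp
  | cons a S ih =>
    simp only [Multiset.map_cons, Multiset.sum_cons, Multiset.card_cons, ih, inner_add_left]
    have : a - v = (a - c) - (v - c) := by abel
    rw [this, norm_sub_sq_real]
    push_cast
    ring

/-- Optimality: replacing one center, and dropping a center. -/
theorem aux_main {d m : ℕ} (X : Multiset (EuclideanSpace ℝ (Fin d)))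
    (C : Fin (m + 1) → EuclideanSpace ℝ (Fin d))
    (hopt : kmcost 2 X C = kmOPT 2 (m + 1) X)
    (Xc : Fin (m + 1) → Multiset (EuclideanSpace ℝ (Fin d)))
    (hpart : ∑ i, Xc i = X)
    (hassign : ∀ i, ∀ x ∈ Xc i, ∀ j, ‖x - C i‖ ≤ ‖x - C j‖)
    (i j : Fin (m + 1)) (hij : j ≠ i) (hne : Xc i ≠ 0) :
    ((Xc i).map fun y => ‖y - C i‖ ^ 2).sum ≤ kmOPT 2 (m + 1) X ∧
    kmOPT 2 m X ≤ kmOPT 2 (m + 1) X + (Xc i).card * ‖C i - C j‖ ^ 2 := by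
  have hn : (0 : ℝ) < (Xc i).card := by exact_mod_cast Multiset.card_pos.2 hne
  have heq := aux_cost_eq (Nat.succ_pos m) Xc C hassign
  rw [hpart, hopt] at heq
  have hsplit : ∀ g : Fin (m + 1) → ℝ, ∑ l, g l = g i + ∑ l ∈ Finset.univ.erase i, g l :=
    fun g => (Finset.add_sum_erase _ _ (Finset.mem_univ i)).symm
  rw [hsplit] at heq
  have hS : (Multiset.map (fun x => x - C i) (Xc i)).sum = 0 := by
    set S := (Multiset.map (fun x => x - C i) (Xc i)).sum with hSdef
    have h1 := aux_opt_le X (Function.update C i (C i + ((Xc i).card : ℝ)⁻¹ • S))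
    have h2 := aux_cost_le Xc (Function.update C i (C i + ((Xc i).card : ℝ)⁻¹ • S)) id
    rw [hpart, hsplit] at h2
    have h3 : ∑ l ∈ Finset.univ.erase i, ((Xc l).map fun x =>
        ‖x - Function.update C i (C i + ((Xc i).card : ℝ)⁻¹ • S) (id l)‖ ^ 2).sum
        = ∑ l ∈ Finset.univ.erase i, ((Xc l).map fun x => ‖x - C l‖ ^ 2).sum := by
      refine Finset.sum_congr rfl fun l hl => ?_
      rw [id, Function.update_of_ne (Finset.ne_of_mem_erase hl)]
    rw [h3] at h2
    simp only [id, Function.update_self] at h2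
    rw [aux_shift (Xc i) (C i), add_sub_cancel_left, ← hSdef, inner_smul_right,
      real_inner_self_eq_norm_sq, norm_smul, mul_pow, Real.norm_eq_abs, sq_abs] at h2
    have h4 : ((Xc i).card : ℝ) * (((Xc i).card : ℝ)⁻¹ ^ 2 * ‖S‖ ^ 2)
      = ((Xc i).card : ℝ)⁻¹ * ‖S‖ ^ 2 := by field_simp
    rw [h4] at h2
    have h5 : ((Xc i).card : ℝ)⁻¹ * ‖S‖ ^ 2 ≤ 0 := by linarith
    have h6 : ‖S‖ ^ 2 ≤ 0 := by
      by_contra hc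
      push Not at hc
      have := mul_pos (inv_pos.2 hn) hc
      linarith
    have h7 : ‖S‖ = 0 := by nlinarith [norm_nonneg S]
    exact norm_eq_zero.1 h7
  constructor
  · have : 0 ≤ ∑ l ∈ Finset.univ.erase i, ((Xc l).map fun x => ‖x - C l‖ ^ 2).sum := by
      refine Finset.sum_nonneg fun l _ => Multiset.sum_nonneg ?_
      intro a ha
      obtain ⟨x, -, rfl⟩ := Multiset.mem_map.1 ha
      positivity
    linarith
  · have hex : ∀ l : Fin (m + 1), ∃ q : Fin m,
        i.succAbove q = if l = i then j else l := by
      intro l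
      apply Fin.exists_succAbove_eq
      split_ifs with h
      · exact hij
      · exact h
    choose f hf using hex
    have h1 := aux_opt_le X (C ∘ i.succAbove)
    have h2 := aux_cost_le Xc (C ∘ i.succAbove) f
    simp only [Function.comp, hf] at h2 h1
    rw [hpart, hsplit] at h2
    have h3 : ∑ l ∈ Finset.univ.erase i, ((Xc l).map fun x =>
        ‖x - C (if l = i then j else l)‖ ^ 2).sum
        = ∑ l ∈ Finset.univ.erase i, ((Xc l).map fun x => ‖x - C l‖ ^ 2).sum := by
      refine Finset.sum_congr rfl fun l hl => ?_
      rw [if_neg (Finset.ne_of_mem_erase hl)]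
    rw [h3, if_pos rfl, aux_shift (Xc i) (C i), hS, inner_zero_left, norm_sub_rev (C j)] at h2
    linarith

theorem aux_Dmin {d k : ℕ} (hk : 2 ≤ k) (C : Fin k → EuclideanSpace ℝ (Fin d)) (i : Fin k) :
    (∀ j, j ≠ i → Dmin C i ≤ ‖C i - C j‖) ∧ ∃ j, j ≠ i ∧ Dmin C i = ‖C i - C j‖ := by
  haveI : Nontrivial (Fin k) := Fin.nontrivial_iff_two_le.2 hk
  obtain ⟨j0, hj0⟩ := exists_ne i
  haveI : Nonempty {j : Fin k // j ≠ i} := ⟨⟨j0, hj0⟩⟩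
  constructor
  · intro j hj
    exact ciInf_le (f := fun j : {j : Fin k // j ≠ i} => ‖C i - C j.1‖)
      (Set.finite_range _).bddBelow ⟨j, hj⟩
  · obtain ⟨j, hj⟩ := exists_eq_ciInf_of_finite
      (f := fun j : {j : Fin k // j ≠ i} => ‖C i - C j.1‖)
    exact ⟨j.1, j.2, hj.symm⟩

/-- For a `φ`-separated instance and a good private center set `B`, the clear-preference sets
satisfy `X_i^cor ⊆ X̂_i ⊆ X*_i` (with `ρ = 100φ²/(1−φ²)`). -/
theorem stmt7 {d k : ℕ} (hk : 2 ≤ k) (φ w : ℝ) (hφ0 : 0 < φ) (hφ1 : φ < 1) (hw : 0 ≤ w)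
    (hcond : φ ^ 2 * (w + 1) / (1 - φ ^ 2) ≤ 1 / 784)
    (X : Multiset (EuclideanSpace ℝ (Fin d)))
    (hsep : kmOPT 2 k X ≤ φ ^ 2 * kmOPT 2 (k - 1) X)
    (Cstar : Fin k → EuclideanSpace ℝ (Fin d)) (hinj : Function.Injective Cstar)
    (hopt : kmcost 2 X Cstar = kmOPT 2 k X)
    (Xc : Fin k → Multiset (EuclideanSpace ℝ (Fin d)))
    (hpart : ∑ i, Xc i = X)
    (hassign : ∀ i, ∀ x ∈ Xc i, ∀ j, ‖x - Cstar i‖ ≤ ‖x - Cstar j‖)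
    (htie : ∀ i x, ‖x - Cstar i‖ < Dmin Cstar i / 2 → (Xc i).count x = X.count x)
    (hne : ∀ i, Xc i ≠ 0)
    (B : Fin k → EuclideanSpace ℝ (Fin d)) (hBinj : Function.Injective B)
    (hB : kmcost 2 X B ≤ w * φ ^ 2 * kmOPT 2 (k - 1) X)
    (hBC : ∀ i, ‖B i - Cstar i‖ ≤
      2 * Real.sqrt (φ ^ 2 * (w + 1) / (1 - φ ^ 2)) * Dmin Cstar i) :
    ∀ i,
      ((Xc i).filter fun x =>
          ‖x - Cstar i‖ ≤
            Real.sqrt (((Xc i).card : ℝ)⁻¹ * (((Xc i).map fun y => ‖y - Cstar i‖ ^ 2).sum))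
              / Real.sqrt (100 * φ ^ 2 / (1 - φ ^ 2)))
        ≤ (X.filter fun x => ‖x - B i‖ ≤ Dmin B i / 3) ∧
      (X.filter fun x => ‖x - B i‖ ≤ Dmin B i / 3) ≤ Xc i := by
  intro i
  obtain ⟨m, rfl⟩ : ∃ m, k = m + 1 := ⟨k - 1, by omega⟩
  have hφ2 : 0 < 1 - φ ^ 2 := by nlinarith
  obtain ⟨hDle, j, hji, hDj⟩ := aux_Dmin hk Cstar i
  obtain ⟨hBle, l, hli, hBl⟩ := aux_Dmin hk B i
  have hDnn : ∀ a, 0 ≤ Dmin Cstar a := fun a => Real.iInf_nonneg fun _ => norm_nonneg _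
  have hDpos : 0 < Dmin Cstar i := by
    rw [hDj]
    exact norm_pos_iff.2 (sub_ne_zero.2 fun h => hji (hinj h).symm)
  have hsq : Real.sqrt (φ ^ 2 * (w + 1) / (1 - φ ^ 2)) ≤ 1 / 28 := by
    rw [show (1 / 28 : ℝ) = Real.sqrt ((1 / 28) ^ 2) from (Real.sqrt_sq (by norm_num)).symm]
    exact Real.sqrt_le_sqrt (hcond.trans (by norm_num))
  have hb : ∀ a, ‖B a - Cstar a‖ ≤ Dmin Cstar a / 14 := fun a =>
    (hBC a).trans (by nlinarith [hDnn a])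
  have hDji : Dmin Cstar j ≤ Dmin Cstar i := by
    have := (aux_Dmin hk Cstar j).1 i hji.symm
    rwa [norm_sub_rev, ← hDj] at this
  have hup : Dmin B i ≤ 8 / 7 * Dmin Cstar i := by
    have h1 := hBle j hji
    have h2 : ‖B i - B j‖ ≤ ‖B i - Cstar i‖ + ‖Cstar i - Cstar j‖ + ‖B j - Cstar j‖ := by
      rw [show B i - B j = (B i - Cstar i) + (Cstar i - Cstar j) - (B j - Cstar j) by abel]
      exact (norm_sub_le _ _).trans (by gcongr; exact norm_add_le _ _)
    linarith [hb i, hb j]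
  have hlo : 6 / 7 * Dmin Cstar i ≤ Dmin B i := by
    have h2 : ‖Cstar i - Cstar l‖ ≤ ‖B i - Cstar i‖ + ‖B i - B l‖ + ‖B l - Cstar l‖ := by
      rw [show Cstar i - Cstar l = (B i - B l) - (B i - Cstar i) + (B l - Cstar l) by abel]
      have h3 := norm_add_le ((B i - B l) - (B i - Cstar i)) (B l - Cstar l)
      have h4 := norm_sub_le (B i - B l) (B i - Cstar i)
      linarith
    have h3 := (aux_Dmin hk Cstar l).1 i hli.symm
    rw [norm_sub_rev] at h3
    linarith [hb i, hb l, hDle l hli]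
  obtain ⟨hr, hdrop⟩ := aux_main X Cstar hopt Xc hpart hassign i j hji (hne i)
  have hn : (0 : ℝ) < (Xc i).card := by exact_mod_cast Multiset.card_pos.2 (hne i)
  rw [← hDj] at hdrop
  rw [Nat.add_sub_cancel] at hsep
  have hXle : Xc i ≤ X := by
    rw [← hpart]
    exact Finset.single_le_sum (f := Xc) (fun _ _ => Multiset.zero_le _) (Finset.mem_univ i)
  have hrad : Real.sqrt (((Xc i).card : ℝ)⁻¹ * (((Xc i).map fun y => ‖y - Cstar i‖ ^ 2).sum))
      / Real.sqrt (100 * φ ^ 2 / (1 - φ ^ 2)) ≤ Dmin Cstar i / 10 := by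
    have hρ : 0 < 100 * φ ^ 2 / (1 - φ ^ 2) := by positivity
    rw [div_le_iff₀ (Real.sqrt_pos.2 hρ)]
    apply Real.sqrt_le_iff.2
    refine ⟨by positivity, ?_⟩
    rw [mul_pow, Real.sq_sqrt hρ.le, inv_mul_le_iff₀ hn]
    have e : ((Xc i).card : ℝ) * ((Dmin Cstar i / 10) ^ 2 * (100 * φ ^ 2 / (1 - φ ^ 2)))
      = (φ ^ 2 * ((Xc i).card * Dmin Cstar i ^ 2)) / (1 - φ ^ 2) := by
      field_simp
      ring
    rw [e, le_div_iff₀ hφ2]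
    have h1 : (1 - φ ^ 2) * kmOPT 2 m X ≤ (Xc i).card * Dmin Cstar i ^ 2 := by linarith
    have h2 := mul_le_mul_of_nonneg_left h1 (sq_nonneg φ)
    have h3 := mul_le_mul_of_nonneg_right (hr.trans hsep) hφ2.le
    linarith
  constructor
  · rw [Multiset.le_filter]
    refine ⟨(Multiset.filter_le _ _).trans hXle, fun x hx => ?_⟩
    have hx := (Multiset.mem_filter.1 hx).2.trans hrad
    have h1 : ‖x - B i‖ ≤ ‖x - Cstar i‖ + ‖B i - Cstar i‖ := by
      rw [show x - B i = (x - Cstar i) - (B i - Cstar i) by abel]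
      exact norm_sub_le _ _
    linarith [hb i]
  · rw [Multiset.le_iff_count]
    intro x
    rw [Multiset.count_filter]
    split_ifs with h
    · have h1 : ‖x - Cstar i‖ ≤ ‖x - B i‖ + ‖B i - Cstar i‖ := by
        rw [show x - Cstar i = (x - B i) + (B i - Cstar i) by abel]
        exact norm_add_le _ _
      exact (htie i x (by linarith [hb i])).ge
    · exact Nat.zero_le _
end

section
/- Let X be a multiset of n points and S a multiset of m points, both contained in the closed ball B(0,Λ) ⊂ ℝ^d, let k ≥ 2, φ > 0, L ≥ 1, and for a center set C put Δ(C) = 5·√((Λ²·k·d/(n·m))·cost²_X(C)·L). Assume: (i) for every set C of at most k centers contained in B(0,Λ), |(1/m)·cost²_S(C) − (1/n)·cost²_X(C)| ≤ Δ(C); (ii) OPT²_k(X) ≤ φ²·OPT²_{k−1}(X); and (iii) OPT²_k(X) ≥ 100·(n/m)·Λ²·k·d·L. Then OPT²_k(S) ≤ 4·φ²·OPT²_{k−1}(S); i.e., S is 2φ-separated for k-means. -/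
open scoped BigOperators Classical

/-- The optimal `p`-objective `k`-clustering cost with centers restricted to the closed ball of
radius `Λ` around the origin. -/
noncomputable def kmOPTB (p : ℕ) {d : ℕ} (Λ : ℝ) (k : ℕ)
    (X : Multiset (EuclideanSpace ℝ (Fin d))) : ℝ :=
  ⨅ C : Fin k → (Metric.closedBall (0 : EuclideanSpace ℝ (Fin d)) Λ),
    kmcost p X fun i => (C i : EuclideanSpace ℝ (Fin d))

theorem kmcost_nonneg_aux {d k : ℕ} (X : Multiset (EuclideanSpace ℝ (Fin d)))
    (C : Fin k → EuclideanSpace ℝ (Fin d)) : 0 ≤ kmcost 2 X C := by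
  unfold kmcost
  apply Multiset.sum_nonneg
  intro y hy
  obtain ⟨x, -, rfl⟩ := Multiset.mem_map.1 hy
  exact Real.iInf_nonneg fun i => by positivity

theorem kmOPTB_le_aux {d k : ℕ} (Λ : ℝ) (X : Multiset (EuclideanSpace ℝ (Fin d)))
    (C : Fin k → (Metric.closedBall (0 : EuclideanSpace ℝ (Fin d)) Λ)) :
    kmOPTB 2 Λ k X ≤ kmcost 2 X fun i => (C i : EuclideanSpace ℝ (Fin d)) := by
  unfold kmOPTB
  refine ciInf_le (f := fun C : Fin k → (Metric.closedBall (0 : EuclideanSpace ℝ (Fin d)) Λ) =>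
    kmcost 2 X fun i => (C i : EuclideanSpace ℝ (Fin d))) ⟨0, ?_⟩ C
  rintro _ ⟨C, rfl⟩
  exact kmcost_nonneg_aux _ _

/-- Fewer centers cost at least as much. -/
theorem kmOPTB_le_pred_aux {d k : ℕ} (hk : 2 ≤ k) (Λ : ℝ)
    (X : Multiset (EuclideanSpace ℝ (Fin d)))
    (C : Fin (k - 1) → (Metric.closedBall (0 : EuclideanSpace ℝ (Fin d)) Λ)) :
    kmOPTB 2 Λ k X ≤ kmcost 2 X fun i => (C i : EuclideanSpace ℝ (Fin d)) := by
  refine (kmOPTB_le_aux Λ X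
    (fun i : Fin k => C ⟨min i.1 (k - 2), by omega⟩)).trans ?_
  unfold kmcost
  apply Multiset.sum_map_le_sum_map
  intro x _
  have : Nonempty (Fin (k - 1)) := ⟨⟨0, by omega⟩⟩
  apply le_ciInf
  intro j
  have h := ciInf_le (f := fun i : Fin k =>
    ‖x - (C ⟨min i.1 (k - 2), by omega⟩ : EuclideanSpace ℝ (Fin d))‖ ^ 2)
    (Set.finite_range _).bddBelow ⟨j.1, by omega⟩
  have e : (⟨min j.1 (k - 2), by omega⟩ : Fin (k - 1)) = j := by
    apply Fin.ext
    simp only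
    omega
  simp only [e] at h
  exact h

/-- Subsamples of a `φ`-separated instance are `2φ`-separated. -/
theorem stmt12 {d k : ℕ} (hk : 2 ≤ k) (Λ φ L : ℝ) (hΛ : 0 < Λ) (hφ : 0 < φ) (hL : 1 ≤ L)
    (X S : Multiset (EuclideanSpace ℝ (Fin d)))
    (hXcard : 0 < X.card) (hScard : 0 < S.card)
    (hXball : ∀ x ∈ X, ‖x‖ ≤ Λ) (hSball : ∀ x ∈ S, ‖x‖ ≤ Λ)
    (hconc : ∀ m : ℕ, m ≤ k → ∀ C : Fin m → EuclideanSpace ℝ (Fin d), (∀ i, ‖C i‖ ≤ Λ) →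
      |(S.card : ℝ)⁻¹ * kmcost 2 S C - (X.card : ℝ)⁻¹ * kmcost 2 X C| ≤
        5 * Real.sqrt (Λ ^ 2 * k * d / ((X.card : ℝ) * (S.card : ℝ)) * kmcost 2 X C * L))
    (hsep : kmOPTB 2 Λ k X ≤ φ ^ 2 * kmOPTB 2 Λ (k - 1) X)
    (hOPT : kmOPTB 2 Λ k X ≥ 100 * ((X.card : ℝ) / (S.card : ℝ)) * Λ ^ 2 * k * d * L) :
    kmOPTB 2 Λ k S ≤ 4 * φ ^ 2 * kmOPTB 2 Λ (k - 1) S := by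
  have hn : (0 : ℝ) < X.card := by exact_mod_cast hXcard
  have hm : (0 : ℝ) < S.card := by exact_mod_cast hScard
  have : Nonempty (Metric.closedBall (0 : EuclideanSpace ℝ (Fin d)) Λ) :=
    ⟨⟨0, by simp [hΛ.le]⟩⟩
  have key : ∀ j : ℕ, j ≤ k → ∀ C : Fin j → EuclideanSpace ℝ (Fin d), (∀ i, ‖C i‖ ≤ Λ) →
      kmOPTB 2 Λ k X ≤ kmcost 2 X C →
      |(S.card : ℝ)⁻¹ * kmcost 2 S C - (X.card : ℝ)⁻¹ * kmcost 2 X C| ≤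
        (X.card : ℝ)⁻¹ * kmcost 2 X C / 2 := by
    intro j hj C hC hle
    refine (hconc j hj C hC).trans ?_
    have h0 := kmcost_nonneg_aux X C
    have h1 : 100 * ((X.card : ℝ) / (S.card : ℝ)) * Λ ^ 2 * k * d * L ≤ kmcost 2 X C :=
      le_trans hOPT hle
    generalize kmcost 2 X C = a at *
    have h2 : Real.sqrt (Λ ^ 2 * k * d / ((X.card : ℝ) * (S.card : ℝ)) * a * L) ≤
        (X.card : ℝ)⁻¹ * a / 10 := by
      apply Real.sqrt_le_iff.2
      refine ⟨by positivity, ?_⟩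
      have h3 := mul_le_mul_of_nonneg_right h1
        (show 0 ≤ a / (100 * (X.card : ℝ) ^ 2) by positivity)
      calc _ = 100 * ((X.card : ℝ) / (S.card : ℝ)) * Λ ^ 2 * k * d * L *
            (a / (100 * (X.card : ℝ) ^ 2)) := by field_simp
        _ ≤ _ := h3
        _ = _ := by field_simp; ring
    linarith
  have hball : ∀ {j : ℕ} (C : Fin j → (Metric.closedBall (0 : EuclideanSpace ℝ (Fin d)) Λ)) i,
      ‖(C i : EuclideanSpace ℝ (Fin d))‖ ≤ Λ := fun C i => by
    exact mem_closedBall_zero_iff.1 (C i).2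
  set N : ℝ := (X.card : ℝ)
  set M : ℝ := (S.card : ℝ)
  -- upper bound with `k` centers
  have hup : (2 / 3) * (N * M⁻¹ * kmOPTB 2 Λ k S) ≤ kmOPTB 2 Λ k X := by
    conv_rhs => unfold kmOPTB
    apply le_ciInf
    intro C
    have h := (abs_le.1 (key k le_rfl _ (hball C) (kmOPTB_le_aux Λ X C))).2
    have h' : M⁻¹ * kmOPTB 2 Λ k S ≤
        3 / 2 * (N⁻¹ * kmcost 2 X fun i => (C i : EuclideanSpace ℝ (Fin d))) := by
      have := mul_le_mul_of_nonneg_left (kmOPTB_le_aux Λ S C) (inv_nonneg.2 hm.le)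
      linarith
    have h2 := mul_le_mul_of_nonneg_left h' hn.le
    have e : N * (3 / 2 * (N⁻¹ * kmcost 2 X fun i => (C i : EuclideanSpace ℝ (Fin d)))) =
        3 / 2 * kmcost 2 X fun i => (C i : EuclideanSpace ℝ (Fin d)) := by field_simp
    rw [e] at h2
    linarith
  have hlow : M * N⁻¹ * kmOPTB 2 Λ (k - 1) X / 2 ≤ kmOPTB 2 Λ (k - 1) S := by
    conv_rhs => unfold kmOPTB
    apply le_ciInf
    intro C
    have h := (abs_le.1 (key (k - 1) (by omega) _ (hball C) (kmOPTB_le_pred_aux hk Λ X C))).1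
    have h' : N⁻¹ * kmOPTB 2 Λ (k - 1) X / 2 ≤
        M⁻¹ * kmcost 2 S fun i => (C i : EuclideanSpace ℝ (Fin d)) := by
      have := mul_le_mul_of_nonneg_left (kmOPTB_le_aux Λ X C) (inv_nonneg.2 hn.le)
      linarith
    have h2 := mul_le_mul_of_nonneg_left h' hm.le
    have e : M * (M⁻¹ * kmcost 2 S fun i => (C i : EuclideanSpace ℝ (Fin d))) =
        kmcost 2 S fun i => (C i : EuclideanSpace ℝ (Fin d)) := by field_simp
    rw [e] at h2
    linarith
  have hnn : 0 ≤ kmOPTB 2 Λ (k - 1) S := Real.iInf_nonneg fun C => kmcost_nonneg_aux _ _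
  have h1 : (2 / 3) * (N * M⁻¹ * kmOPTB 2 Λ k S) ≤ φ ^ 2 * kmOPTB 2 Λ (k - 1) X :=
    hup.trans hsep
  have h2 := mul_le_mul_of_nonneg_left h1 (show 0 ≤ M * N⁻¹ by positivity)
  have e : M * N⁻¹ * ((2 / 3) * (N * M⁻¹ * kmOPTB 2 Λ k S)) = 2 / 3 * kmOPTB 2 Λ k S := by
    field_simp
  rw [e] at h2
  have h3 := mul_le_mul_of_nonneg_left hlow (sq_nonneg φ)
  have h4 := mul_nonneg (sq_nonneg φ) hnn
  linarith
end
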